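/- Let w₁, …, w_n be an arbitrary basis of the span of u₁, …, u_n and let w_{n+1}, …, w_N be an arbitrary basis of the span of u_{n+1}, …, u_N; let Ŭ(x) be the matrix with columns w₁(x), …, w_N(x) and Ğ(x) = Ŭ(x)⁻¹ with entries ğ_{j,l}(x). Then for every l = 1, …, N: ğ_{j,l}(x) = O(e^{ρ₋ x}) as x → −∞ for each j = n+1, …, N, and ğ_{j,l}(x) = O(e^{−ρ₊ x}) as x → +∞ for each j = 1, …, n. -/

import Mathlib

open MeasureTheory Filter Topology Asymptotics

noncomputable section

/-- A (continuous, integrated-sense) solution of the first order system `u' = L(x) u`. -/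
def IsSolV (N : ℕ) (L : ℝ → Matrix (Fin N) (Fin N) ℂ) (u : ℝ → Fin N → ℂ) : Prop :=
  Continuous u ∧ ∀ x₀ x : ℝ, u x = u x₀ + ∫ y in x₀..x, (L y).mulVec (u y)

/-- Where the perturbation vanishes, a solution of the perturbed system is a classical solution of
the constant coefficient system. -/
lemma IsSolV.hasDerivAt {N : ℕ} {L₀ : Matrix (Fin N) (Fin N) ℂ}
    {V : ℝ → Matrix (Fin N) (Fin N) ℂ} {u : ℝ → Fin N → ℂ}
    (hu : IsSolV N (fun x => L₀ + V x) u) {S : Set ℝ} (hSo : IsOpen S) (hSc : S.OrdConnected)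
    (hV : ∀ x ∈ S, V x = 0) {x : ℝ} (hx : x ∈ S) :
    HasDerivAt u (L₀.mulVec (u x)) x := by
  have hcont : Continuous fun y => L₀.mulVec (u y) := continuous_const.matrix_mulVec hu.1
  have hd : HasDerivAt (fun z => u x + ∫ y in x..z, L₀.mulVec (u y)) (L₀.mulVec (u x)) x :=
    ((hcont.integral_hasStrictDerivAt x x).hasDerivAt).const_add (u x)
  refine hd.congr_of_eventuallyEq ?_
  filter_upwards [hSo.mem_nhds hx] with z hz
  rw [hu.2 x z]
  congr 1
  refine intervalIntegral.integral_congr fun y hy => ?_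
  simp [hV y (hSc.uIcc_subset hx hz hy)]

/-- Eigenvectors for distinct eigenvalues are the columns of an invertible matrix. -/
lemma Matrix.isUnit_of_eigenvectors {ι : Type*} [Fintype ι] [DecidableEq ι] {L₀ : Matrix ι ι ℂ}
    {ζ : ι → ℂ} {p : ι → ι → ℂ} (hdist : Function.Injective ζ)
    (heig : ∀ j, L₀.mulVec (p j) = ζ j • p j) (hp0 : ∀ j, p j ≠ 0) :
    IsUnit (Matrix.of fun k j => p j k) := by
  rw [← Matrix.linearIndependent_cols_iff_isUnit]
  refine Module.End.eigenvectors_linearIndependent' (Matrix.toLin' L₀) ζ hdist p fun j => ?_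
  rw [Module.End.hasEigenvector_iff, Module.End.mem_eigenspace_iff]
  exact ⟨by rw [Matrix.toLin'_apply, heig], hp0 j⟩

/-- A scalar solution of `f' = z f` on an open convex set is a multiple of `exp (z x)`. -/
lemma exists_eq_exp_mul_of_hasDerivAt {S : Set ℝ} (hSo : IsOpen S) (hSc : Convex ℝ S) {z : ℂ}
    {f : ℝ → ℂ} (hf : ∀ x ∈ S, HasDerivAt f (z * f x) x) :
    ∃ c : ℂ, ∀ x ∈ S, f x = Complex.exp (z * x) * c := by
  have hd : ∀ x ∈ S, HasDerivAt (fun y : ℝ => Complex.exp (-(z * y)) * f y) 0 x := by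
    intro x hx
    have h1 : HasDerivAt (fun y : ℝ => -(z * (y : ℂ))) (-(z * 1)) x :=
      ((Complex.ofRealCLM.hasDerivAt (x := x)).const_mul z).neg
    refine (h1.cexp.mul (hf x hx)).congr_deriv ?_
    ring
  obtain ⟨c, hc⟩ := hSo.exists_is_const_of_deriv_eq_zero hSc.isPreconnected
    (fun x hx => (hd x hx).differentiableAt.differentiableWithinAt) (fun x hx => (hd x hx).deriv)
  refine ⟨c, fun x hx => ?_⟩
  rw [← hc x hx, ← mul_assoc, ← Complex.exp_add]
  simp

/-- The general solution of a diagonalised constant coefficient system, in matrix form. -/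
lemma exists_eq_mul_diagonal_exp_mul {ι : Type*} [Fintype ι] [DecidableEq ι] {L₀ P : Matrix ι ι ℂ}
    {ζ : ι → ℂ} (hP : IsUnit P) (hLP : L₀ * P = P * Matrix.diagonal ζ)
    {S : Set ℝ} (hSo : IsOpen S) (hSc : Convex ℝ S) {W : ℝ → Matrix ι ι ℂ}
    (hW : ∀ x ∈ S, ∀ j, HasDerivAt (fun y => (W y).col j) (L₀.mulVec ((W x).col j)) x) :
    ∃ C : Matrix ι ι ℂ, ∀ x ∈ S,
      W x = P * Matrix.diagonal (fun k => Complex.exp (ζ k * x)) * C := by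
  have hdet : IsUnit P.det := (Matrix.isUnit_iff_isUnit_det P).1 hP
  have hPL : P⁻¹ * L₀ = Matrix.diagonal ζ * P⁻¹ := by
    rw [← Matrix.mul_nonsing_inv_cancel_right P (P⁻¹ * L₀) hdet, Matrix.mul_assoc P⁻¹, hLP,
      Matrix.nonsing_inv_mul_cancel_left _ _ hdet]
  have hd : ∀ k j, ∀ x ∈ S,
      HasDerivAt (fun y => (P⁻¹ * W y) k j) (ζ k * (P⁻¹ * W x) k j) x := by
    intro k j x hx
    have h1 : HasDerivAt (fun y => ∑ i, P⁻¹ k i * W y i j)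
        (∑ i, P⁻¹ k i * (L₀.mulVec ((W x).col j)) i) x :=
      HasDerivAt.fun_sum fun i _ => (hasDerivAt_pi.1 (hW x hx j) i).const_mul _
    have h2 : ∑ i, P⁻¹ k i * (L₀.mulVec ((W x).col j)) i = ζ k * (P⁻¹ * W x) k j := by
      rw [← Matrix.diagonal_mul, ← Matrix.mul_assoc, ← hPL, Matrix.mul_assoc]
      rfl
    rw [← h2]
    exact h1
  choose C hC using fun k j => exists_eq_exp_mul_of_hasDerivAt hSo hSc (hd k j)
  refine ⟨Matrix.of C, fun x hx => ?_⟩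
  rw [Matrix.mul_assoc, ← Matrix.mul_nonsing_inv_cancel_left P (W x) hdet]
  congr 1
  ext k j
  rw [Matrix.diagonal_mul, hC k j x hx, Matrix.of_apply]

/-- If a fundamental matrix `W` of a diagonalised system spans, with its columns in `J`, the
exponential solutions with index in `J`, then the rows of `W⁻¹` outside `J` are combinations of
`exp (-ζ k x)` with `k` outside `J`. -/
lemma isBigO_inv_fundamental_matrix {ι : Type*} [Fintype ι] [DecidableEq ι] {L₀ : Matrix ι ι ℂ}
    {ζ : ι → ℂ} {p : ι → ι → ℂ} (hdist : Function.Injective ζ)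
    (heig : ∀ j, L₀.mulVec (p j) = ζ j • p j) (hp0 : ∀ j, p j ≠ 0)
    {S : Set ℝ} (hSo : IsOpen S) (hSc : Convex ℝ S) (hSn : S.Nonempty) {W : ℝ → Matrix ι ι ℂ}
    (hW : ∀ x ∈ S, ∀ j, HasDerivAt (fun y => (W y).col j) (L₀.mulVec ((W x).col j)) x)
    (hdetW : ∀ x ∈ S, (W x).det ≠ 0) {J : Set ι}
    (hJ : ∀ k ∈ J, ∃ b : ι → ℂ, (∀ j ∉ J, b j = 0) ∧
      ∀ x ∈ S, Complex.exp (ζ k * x) • p k = (W x).mulVec b)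
    {F : Filter ℝ} (hF : S ∈ F) {g : ℝ → ℝ}
    (hg : ∀ k ∉ J, (fun x : ℝ => Complex.exp (-(ζ k * x))) =O[F] g) {j : ι} (hj : j ∉ J) (l : ι) :
    (fun x => (W x)⁻¹ j l) =O[F] g := by
  set P : Matrix ι ι ℂ := Matrix.of fun k j => p j k with hPdef
  have hP : IsUnit P := Matrix.isUnit_of_eigenvectors hdist heig hp0
  have hLP : L₀ * P = P * Matrix.diagonal ζ := by
    ext i k
    rw [Matrix.mul_diagonal]
    have := congrFun (heig k) i
    rw [Pi.smul_apply, smul_eq_mul, mul_comm] at this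
    exact this
  obtain ⟨C, hC⟩ := exists_eq_mul_diagonal_exp_mul hP hLP hSo hSc hW
  have hPdet : IsUnit P.det := (Matrix.isUnit_iff_isUnit_det P).1 hP
  obtain ⟨x₀, hx₀⟩ := hSn
  have hCdet : IsUnit C.det := by
    refine isUnit_iff_ne_zero.2 fun h => hdetW x₀ hx₀ ?_
    rw [hC x₀ hx₀, Matrix.det_mul, h, mul_zero]
  have hEE : ∀ x : ℝ, Matrix.diagonal (fun k => Complex.exp (-(ζ k * x))) *
      Matrix.diagonal (fun k => Complex.exp (ζ k * x)) = 1 := by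
    intro x
    simp [Matrix.diagonal_mul_diagonal, ← Complex.exp_add]
  have hinv : ∀ x ∈ S,
      (W x)⁻¹ = C⁻¹ * (Matrix.diagonal (fun k => Complex.exp (-(ζ k * x))) * P⁻¹) := by
    intro x hx
    rw [hC x hx, Matrix.mul_inv_rev, Matrix.mul_inv_rev, Matrix.inv_eq_left_inv (hEE x)]
  have hzero : ∀ k ∈ J, C⁻¹ j k = 0 := by
    intro k hk
    obtain ⟨b, hb0, hb⟩ := hJ k hk
    have hbx := hb x₀ hx₀
    have hpk : p k = P.mulVec (Pi.single k 1) := by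
      ext i
      simp [hPdef]
    have hWb : (W x₀)⁻¹.mulVec (Complex.exp (ζ k * x₀) • p k) = b := by
      rw [hbx, Matrix.mulVec_mulVec,
        Matrix.nonsing_inv_mul _ (isUnit_iff_ne_zero.2 (hdetW x₀ hx₀)), Matrix.one_mulVec]
    rw [hinv x₀ hx₀, hpk, Matrix.mulVec_smul, Matrix.mulVec_mulVec, Matrix.mul_assoc,
      Matrix.mul_assoc, Matrix.nonsing_inv_mul _ hPdet, Matrix.mul_one] at hWb
    have h := congrFun hWb j
    rw [hb0 j hj] at h
    simpa [Matrix.mul_diagonal, Complex.exp_ne_zero] using h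
  have hsum : (fun x : ℝ => ∑ k, C⁻¹ j k * (Complex.exp (-(ζ k * x)) * P⁻¹ k l)) =O[F] g := by
    refine IsBigO.fun_sum fun k _ => ?_
    by_cases hk : k ∈ J
    · simp [hzero k hk, isBigO_zero]
    · simpa only [mul_comm, mul_left_comm, mul_assoc] using
        ((hg k hk).const_mul_left (P⁻¹ k l)).const_mul_left (C⁻¹ j k)
  refine hsum.congr' ?_ EventuallyEq.rfl
  filter_upwards [hF] with x hx
  rw [hinv x hx, Matrix.mul_apply]
  simp only [Matrix.diagonal_mul]

/-- An element of the span of the `w j`, `j ∈ J`, is pointwise the product of the matrix with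
columns `w j x` and a fixed coefficient vector supported in `J`. -/
lemma exists_mulVec_of_mem_span_image {ι X : Type*} [Fintype ι] {w : ι → X → ι → ℂ}
    {J : Set ι} {f : X → ι → ℂ} (hf : f ∈ Submodule.span ℂ (w '' J)) :
    ∃ b : ι → ℂ, (∀ j ∉ J, b j = 0) ∧
      ∀ x, f x = (Matrix.of fun k j => w j x k).mulVec b := by
  obtain ⟨b, hb, rfl⟩ := (Finsupp.mem_span_image_iff_linearCombination ℂ).1 hf
  refine ⟨b, fun j hj => Finsupp.notMem_support_iff.1 fun h => hj (hb h), fun x => ?_⟩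
  ext k
  simp [Finsupp.linearCombination_apply, Finsupp.sum_fintype, Matrix.mulVec, dotProduct, mul_comm]

/-- Being a solution of a constant coefficient system passes to linear spans. -/
lemma hasDerivAt_of_mem_span {ι : Type*} [Fintype ι] {L₀ : Matrix ι ι ℂ} {A : Set (ℝ → ι → ℂ)}
    {x : ℝ} (hA : ∀ f ∈ A, HasDerivAt f (L₀.mulVec (f x)) x) {f : ℝ → ι → ℂ}
    (hf : f ∈ Submodule.span ℂ A) : HasDerivAt f (L₀.mulVec (f x)) x := by
  induction hf using Submodule.span_induction with
  | mem f hf => exact hA f hf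
  | zero => simp
  | add f g _ _ hf hg => simpa [Matrix.mulVec_add] using hf.add hg
  | smul c f _ hf => simpa [Matrix.mulVec_smul] using hf.const_smul c

/-- if `w₁,…,w_n` is an arbitrary basis of the span of `u₁,…,u_n` and
`w_{n+1},…,w_N` an arbitrary basis of the span of `u_{n+1},…,u_N`, and `Ğ(x) = Ŭ(x)⁻¹` is the
inverse of the matrix with columns `w_j(x)`, then for every `l`: `ğ_{j,l}(x) = O(e^{ρ₋x})` as
`x → −∞` for `j = n+1,…,N` and `ğ_{j,l}(x) = O(e^{−ρ₊x})` as `x → +∞` for `j = 1,…,n`. -/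
theorem statement_5 (N n : ℕ) (hN : 1 ≤ N) (hn : n ≤ N)
    (L₀ : Matrix (Fin N) (Fin N) ℂ) (ζ : Fin N → ℂ) (p : Fin N → Fin N → ℂ)
    (hdist : Function.Injective ζ)
    (heig : ∀ j, L₀.mulVec (p j) = ζ j • p j) (hp0 : ∀ j, p j ≠ 0)
    (hre : ∀ j, (ζ j).re ≠ 0)
    (hpos : ∀ j : Fin N, (j : ℕ) < n → 0 < (ζ j).re)
    (hneg : ∀ j : Fin N, n ≤ (j : ℕ) → (ζ j).re < 0)
    (a : ℝ) (ha : 0 < a)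
    (V : ℝ → Matrix (Fin N) (Fin N) ℂ)
    (hVloc : ∀ i j : Fin N, MeasureTheory.LocallyIntegrable fun x : ℝ => V x i j)
    (hVsupp : ∀ x : ℝ, x ∉ Set.Icc (-a) a → V x = 0)
    (u : Fin N → ℝ → Fin N → ℂ)
    (husol : ∀ j, IsSolV N (fun x => L₀ + V x) (u j))
    (hbcm : ∀ j : Fin N, (j : ℕ) < n → ∀ x : ℝ, x < -a → u j x = Complex.exp (ζ j * x) • p j)
    (hbcp : ∀ j : Fin N, n ≤ (j : ℕ) → ∀ x : ℝ, x > a → u j x = Complex.exp (ζ j * x) • p j)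
    (huli : LinearIndependent ℂ u)
    (ρp ρm : ℝ)
    (hρp : IsLeast ((fun j => (ζ j).re) '' {j : Fin N | (j : ℕ) < n}) ρp)
    (hρm : IsLeast ((fun j => |(ζ j).re|) '' {j : Fin N | n ≤ (j : ℕ)}) ρm)
    (w : Fin N → ℝ → Fin N → ℂ)
    (hwspanp : Submodule.span ℂ (w '' {j : Fin N | (j : ℕ) < n}) =
      Submodule.span ℂ (u '' {j : Fin N | (j : ℕ) < n}))
    (hwlip : LinearIndependent ℂ (fun j : {j : Fin N // (j : ℕ) < n} => w j.1))
    (hwspanm : Submodule.span ℂ (w '' {j : Fin N | n ≤ (j : ℕ)}) =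
      Submodule.span ℂ (u '' {j : Fin N | n ≤ (j : ℕ)}))
    (hwlim : LinearIndependent ℂ (fun j : {j : Fin N // n ≤ (j : ℕ)} => w j.1))
    (Uw : ℝ → Matrix (Fin N) (Fin N) ℂ)
    (hUw : ∀ x, Uw x = Matrix.of fun k j => w j x k)
    (hdetW : ∀ x, (Uw x).det ≠ 0) :
    ∀ l : Fin N,
      (∀ j : Fin N, n ≤ (j : ℕ) →
        (fun x : ℝ => (Uw x)⁻¹ j l) =O[atBot] fun x : ℝ => Real.exp (ρm * x)) ∧
      (∀ j : Fin N, (j : ℕ) < n →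
        (fun x : ℝ => (Uw x)⁻¹ j l) =O[atTop] fun x : ℝ => Real.exp (-ρp * x)) := by
  have hup : ∀ k : Fin N, (k : ℕ) < n → u k ∈ Submodule.span ℂ (w '' {j : Fin N | (j : ℕ) < n}) :=
    fun k hk => hwspanp.symm ▸ Submodule.subset_span (Set.mem_image_of_mem u hk)
  have hum : ∀ k : Fin N, n ≤ (k : ℕ) → u k ∈ Submodule.span ℂ (w '' {j : Fin N | n ≤ (j : ℕ)}) :=
    fun k hk => hwspanm.symm ▸ Submodule.subset_span (Set.mem_image_of_mem u hk)
  have hspan : ∀ j, w j ∈ Submodule.span ℂ (Set.range u) := by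
    intro j
    rcases lt_or_ge (j : ℕ) n with h | h
    · exact Submodule.span_mono (Set.image_subset_range u _)
        (hwspanp.le (Submodule.subset_span (Set.mem_image_of_mem w h)))
    · exact Submodule.span_mono (Set.image_subset_range u _)
        (hwspanm.le (Submodule.subset_span (Set.mem_image_of_mem w h)))
  have hcol : ∀ S : Set ℝ, IsOpen S → S.OrdConnected → (∀ x ∈ S, V x = 0) → ∀ x ∈ S, ∀ j,
      HasDerivAt (fun y => (Uw y).col j) (L₀.mulVec ((Uw x).col j)) x := by
    intro S hSo hSc hV x hx j
    simp only [hUw]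
    refine hasDerivAt_of_mem_span (A := Set.range u) ?_ (hspan j)
    rintro _ ⟨i, rfl⟩
    exact (husol i).hasDerivAt hSo hSc hV hx
  intro l
  constructor
  · intro j hj
    refine isBigO_inv_fundamental_matrix hdist heig hp0 (S := Set.Iio (-a)) isOpen_Iio
      (convex_Iio _) Set.nonempty_Iio
      (hcol _ isOpen_Iio Set.ordConnected_Iio fun x hx => hVsupp x fun h => not_le.2 hx h.1)
      (fun x _ => hdetW x) (J := {j : Fin N | (j : ℕ) < n}) ?_ (Iio_mem_atBot _) ?_
      (not_lt.2 hj) l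
    · intro k hk
      obtain ⟨b, hb0, hb⟩ := exists_mulVec_of_mem_span_image (hup k hk)
      exact ⟨b, hb0, fun x hx => by rw [← hbcm k hk x hx, hb x, hUw]⟩
    · intro k hk
      have hk' : n ≤ (k : ℕ) := not_lt.1 hk
      have hle : ρm ≤ -(ζ k).re := by
        rw [← abs_of_neg (hneg k hk')]
        exact hρm.2 ⟨k, hk', rfl⟩
      refine IsBigO.of_bound 1 ?_
      filter_upwards [eventually_le_atBot 0] with x hx
      rw [Complex.norm_exp, Real.norm_of_nonneg (Real.exp_pos _).le, one_mul]
      refine Real.exp_le_exp.2 ?_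
      simp only [Complex.neg_re, Complex.re_mul_ofReal]
      nlinarith
  · intro j hj
    refine isBigO_inv_fundamental_matrix hdist heig hp0 (S := Set.Ioi a) isOpen_Ioi
      (convex_Ioi _) Set.nonempty_Ioi
      (hcol _ isOpen_Ioi Set.ordConnected_Ioi fun x hx => hVsupp x fun h => not_le.2 hx h.2)
      (fun x _ => hdetW x) (J := {j : Fin N | n ≤ (j : ℕ)}) ?_ (Ioi_mem_atTop _) ?_
      (not_le.2 hj) l
    · intro k hk
      obtain ⟨b, hb0, hb⟩ := exists_mulVec_of_mem_span_image (hum k hk)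
      exact ⟨b, hb0, fun x hx => by rw [← hbcp k hk x hx, hb x, hUw]⟩
    · intro k hk
      have hk' : (k : ℕ) < n := not_le.1 hk
      have hle : ρp ≤ (ζ k).re := hρp.2 ⟨k, hk', rfl⟩
      refine IsBigO.of_bound 1 ?_
      filter_upwards [eventually_ge_atTop 0] with x hx
      rw [Complex.norm_exp, Real.norm_of_nonneg (Real.exp_pos _).le, one_mul]
      refine Real.exp_le_exp.2 ?_
      simp only [Complex.neg_re, Complex.re_mul_ofReal]
      nlinarith
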